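/- arXiv:1606.08220 — 2 statements merged into one kernel-verified Lean document; each statement's English description precedes it below -/
import Mathlib

section
/- (Lemma 4.2.) Let Q = diag(q_1,…,q_n) with q_i > 0, B ∈ ℝ^{n×m} with ker(Bᵀ) = span{𝟙}, L_c ∈ ℝ^{n×n} with L_c𝟙 = 0, gains γ_c, γ_e, γ_p, γ_l > 0, d, r, x̄_0, x̄_s, u_p^-, u_p^+ ∈ ℝ^n, u_e^+ ∈ ℝ^m, x̄(t) := x̄_0 + x̄_s t. Suppose x, x_p : [0,∞) → ℝ^n, x_e : [0,∞) → ℝ^m are differentiable and satisfy for all t ≥ 0, with y := x − x̄(t), u_e := sat(−γ_c Bᵀ y − γ_e x_e; 0, u_e^+), u_p := sat(Q^{-1}(γ_p x_p − r); u_p^-, u_p^+): ẋ = B u_e + u_p + d, ẋ_p = −γ_l L_c sat(x_p; (1/γ_p)(Q u_p^- + r), (1/γ_p)(Q u_p^+ + r)) − γ_p Q^{-1}(y − γ_c B u_e), ẋ_e = γ_e Bᵀ y. Let x̄_p := −(1/γ_p)(𝟙𝟙ᵀ/(𝟙ᵀQ^{-1}𝟙)) d̃ with d̃ := d − x̄_s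 − Q^{-1}r, let x̄_e solve γ_e B x̄_e = −Q̄ Q d̃, and let (x̂, x̂_e, x̂_p) satisfy Bᵀx̂ = 0, −γ_e B x̂_e + γ_p Q^{-1} x̂_p = 0, and −γ_p Q^{-1} x̂ − γ_l L_c x̂_p − γ_p γ_c γ_e Q^{-1} B(x̂_e + x̄_e) = 0. Then the incremental states x̃ := x − x̄ − x̂, x̃_p := x_p − x̄_p − x̂_p, x̃_e := x_e − x̄_e − x̂_e satisfy for all t ≥ 0: x̃' = B sat_e(x̃, x̃_e) + γ_p Q^{-1} sat_p(x̃_p), x̃_p' = −γ_l L_c sat_p(x̃_p) + γ_p γ_c Q^{-1} B sat_e(x̃, x̃_e) − γ_p Q^{-1} x̃, x̃_e' = γ_e Bᵀ x̃, where sat_e(x̃, x̃_e) := sat(−γ_c Bᵀ x̃ − γ_e x̃_e; x_e^-, x_e^+), sat_p(x̃_p) := sat(x̃_p; x_p^-, x_p^+), x_e^- := γ_e(x̄_e + x̂_e), x_e^+ := γ_e(x̄_e + x̂_e) + u_e^+, x_p^- := (1/γ_p)(Q u_p^- + r) − (x̄_p + x̂_p), x_p^+ := (1/γ_p)(Q u_p^+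 + r) − (x̄_p + x̂_p). -/
open Matrix Filter

/-- Euclidean norm on `Fin k → ℝ`. -/
noncomputable def euclNorm {k : ℕ} (v : Fin k → ℝ) : ℝ :=
  ‖(WithLp.equiv 2 (Fin k → ℝ)).symm v‖

/-- Operator norm on matrices induced by the Euclidean norms. -/
noncomputable def matOpNorm {k l : ℕ} (A : Matrix (Fin k) (Fin l) ℝ) : ℝ :=
  ‖LinearMap.toContinuousLinearMap (Matrix.toEuclideanLin A)‖

/-- The all-ones vector `𝟙`. -/
def onesVec (k : ℕ) : Fin k → ℝ := fun _ => 1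

/-- The all-ones matrix `𝟙𝟙ᵀ`. -/
def onesMat (k : ℕ) : Matrix (Fin k) (Fin k) ℝ := Matrix.of fun _ _ => 1

/-- Scalar saturation: `sat(y; l, u) = l` if `y ≤ l`, `u` if `u ≤ y`, and `y` otherwise. -/
noncomputable def sat1 (y l u : ℝ) : ℝ := if y ≤ l then l else if u ≤ y then u else y

/-- Componentwise (multidimensional) saturation function. -/
noncomputable def satv {k : ℕ} (x xm xp : Fin k → ℝ) : Fin k → ℝ :=
  fun i => sat1 (x i) (xm i) (xp i)

theorem sat1_shift (y l u c : ℝ) : sat1 (y + c) (l + c) (u + c) = sat1 y l u + c := by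
  unfold sat1
  simp only [add_le_add_iff_right]
  split_ifs <;> rfl

theorem sat1_scale (y l u a b : ℝ) (ha : 0 < a) :
    sat1 (a * y + b) (a * l + b) (a * u + b) = a * sat1 y l u + b := by
  unfold sat1
  simp only [add_le_add_iff_right, mul_le_mul_iff_right₀ ha]
  split_ifs <;> rfl

/-- Lemma 4.2: the incremental states of the constrained (saturated)
closed loop satisfy the incremental saturated dynamics. -/
theorem lemma42_incremental_saturated_dynamics {n m : ℕ}
    (q : Fin n → ℝ) (hq : ∀ i, 0 < q i)
    (B : Matrix (Fin n) (Fin m) ℝ)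
    (hB : LinearMap.ker Bᵀ.mulVecLin = Submodule.span ℝ {onesVec n})
    (Lc : Matrix (Fin n) (Fin n) ℝ) (hLc1 : Lc *ᵥ onesVec n = 0)
    (γc γe γp γl : ℝ) (hγc : 0 < γc) (hγe : 0 < γe) (hγp : 0 < γp) (hγl : 0 < γl)
    (d r xbar0 xbars upm upp : Fin n → ℝ) (uep : Fin m → ℝ)
    (xbar : ℝ → Fin n → ℝ) (hxbar : ∀ t, xbar t = xbar0 + t • xbars)
    (Q Qinv Qbar : Matrix (Fin n) (Fin n) ℝ)
    (hQ : Q = Matrix.diagonal q)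
    (hQinv : Qinv = Matrix.diagonal fun i => (q i)⁻¹)
    (hQbar : Qbar =
      (onesVec n ⬝ᵥ (Qinv *ᵥ onesVec n))⁻¹ • (Qinv * onesMat n * Qinv) - Qinv)
    (dtil : Fin n → ℝ) (hdtil : dtil = d - xbars - Qinv *ᵥ r)
    (x xp : ℝ → Fin n → ℝ) (xe : ℝ → Fin m → ℝ)
    (ue : ℝ → Fin m → ℝ) (up : ℝ → Fin n → ℝ)
    (hue : ∀ t, ue t =
      satv (-(γc • (Bᵀ *ᵥ (x t - xbar t))) - γe • xe t) 0 uep)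
    (hup : ∀ t, up t = satv (Qinv *ᵥ (γp • xp t - r)) upm upp)
    (hx : ∀ t ≥ (0:ℝ), HasDerivAt x (B *ᵥ ue t + up t + d) t)
    (hxp : ∀ t ≥ (0:ℝ), HasDerivAt xp
      (-(γl • (Lc *ᵥ satv (xp t) (γp⁻¹ • (Q *ᵥ upm + r)) (γp⁻¹ • (Q *ᵥ upp + r))))
        - γp • (Qinv *ᵥ ((x t - xbar t) - γc • (B *ᵥ ue t)))) t)
    (hxe : ∀ t ≥ (0:ℝ), HasDerivAt xe (γe • (Bᵀ *ᵥ (x t - xbar t))) t)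
    (xbarp : Fin n → ℝ)
    (hxbarp : xbarp =
      -((γp⁻¹ * (onesVec n ⬝ᵥ (Qinv *ᵥ onesVec n))⁻¹) • (onesMat n *ᵥ dtil)))
    (xbare : Fin m → ℝ)
    (hxbare : γe • (B *ᵥ xbare) = -((Qbar * Q) *ᵥ dtil))
    (xhat xhatp : Fin n → ℝ) (xhate : Fin m → ℝ)
    (hhat1 : Bᵀ *ᵥ xhat = 0)
    (hhat2 : -(γe • (B *ᵥ xhate)) + γp • (Qinv *ᵥ xhatp) = 0)
    (hhat3 : -(γp • (Qinv *ᵥ xhat)) - γl • (Lc *ᵥ xhatp)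
      - (γp * γc * γe) • (Qinv *ᵥ (B *ᵥ (xhate + xbare))) = 0)
    (xpLo xpHi : Fin n → ℝ) (xeLo xeHi : Fin m → ℝ)
    (hxpLo : xpLo = γp⁻¹ • (Q *ᵥ upm + r) - (xbarp + xhatp))
    (hxpHi : xpHi = γp⁻¹ • (Q *ᵥ upp + r) - (xbarp + xhatp))
    (hxeLo : xeLo = γe • (xbare + xhate))
    (hxeHi : xeHi = γe • (xbare + xhate) + uep) :
    (∀ t ≥ (0:ℝ), HasDerivAt (fun s => x s - xbar s - xhat)
      (B *ᵥ satv (-(γc • (Bᵀ *ᵥ (x t - xbar t - xhat)))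
          - γe • (xe t - xbare - xhate)) xeLo xeHi
        + γp • (Qinv *ᵥ satv (xp t - xbarp - xhatp) xpLo xpHi)) t) ∧
    (∀ t ≥ (0:ℝ), HasDerivAt (fun s => xp s - xbarp - xhatp)
      (-(γl • (Lc *ᵥ satv (xp t - xbarp - xhatp) xpLo xpHi))
        + (γp * γc) • (Qinv *ᵥ (B *ᵥ satv (-(γc • (Bᵀ *ᵥ (x t - xbar t - xhat)))
            - γe • (xe t - xbare - xhate)) xeLo xeHi))
        - γp • (Qinv *ᵥ (x t - xbar t - xhat))) t) ∧
    (∀ t ≥ (0:ℝ), HasDerivAt (fun s => xe s - xbare - xhate)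
      (γe • (Bᵀ *ᵥ (x t - xbar t - xhat))) t) := by
  have hE : ∀ t, satv (-(γc • (Bᵀ *ᵥ (x t - xbar t - xhat)))
          - γe • (xe t - xbare - xhate)) xeLo xeHi = ue t + γe • (xbare + xhate) := by
    intro t
    rw [hue, hxeLo, hxeHi, Matrix.mulVec_sub Bᵀ (x t - xbar t) xhat, hhat1]
    funext i
    simp only [satv, Pi.add_apply]
    rw [← sat1_shift]
    congr 1
    · simp only [Pi.sub_apply, Pi.neg_apply, Pi.smul_apply, Pi.add_apply, Pi.zero_apply,
        smul_eq_mul]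
      ring
    · simp
    · ring
  have hP : ∀ t, satv (xp t - xbarp - xhatp) xpLo xpHi =
      satv (xp t) (γp⁻¹ • (Q *ᵥ upm + r)) (γp⁻¹ • (Q *ᵥ upp + r)) - (xbarp + xhatp) := by
    intro t
    rw [hxpLo, hxpHi]
    funext i
    simp only [satv, Pi.sub_apply]
    rw [sub_eq_add_neg (sat1 _ _ _), ← sat1_shift]
    congr 1
    simp only [Pi.add_apply]
    ring
  have hU : ∀ t, γp • (Qinv *ᵥ satv (xp t) (γp⁻¹ • (Q *ᵥ upm + r)) (γp⁻¹ • (Q *ᵥ upp + r)))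
      = up t + Qinv *ᵥ r := by
    intro t
    rw [hup, hQ, hQinv]
    funext i
    have hqi := hq i
    simp only [satv, Pi.add_apply, Pi.smul_apply, Matrix.mulVec_diagonal, smul_eq_mul,
      Pi.sub_apply]
    have h := sat1_scale (xp t i) (γp⁻¹ * (q i * upm i + r i)) (γp⁻¹ * (q i * upp i + r i))
      (γp * (q i)⁻¹) (-((q i)⁻¹ * r i)) (by positivity)
    have e1 : ∀ v : ℝ, γp * (q i)⁻¹ * (γp⁻¹ * (q i * v + r i)) + -((q i)⁻¹ * r i) = v := by
      intro v
      field_simp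
      ring
    rw [e1, e1] at h
    have e2 : (q i)⁻¹ * (γp * xp t i - r i) = γp * (q i)⁻¹ * xp t i + -((q i)⁻¹ * r i) := by ring
    rw [e2, h]
    ring
  have hQQ : Qinv * Q = 1 := by
    rw [hQ, hQinv, Matrix.diagonal_mul_diagonal, ← Matrix.diagonal_one]
    congr 1
    funext i
    exact inv_mul_cancel₀ (hq i).ne'
  have hbar : γe • (B *ᵥ xbare) - γp • (Qinv *ᵥ xbarp) = dtil := by
    rw [hxbare, hQbar, hxbarp, Matrix.sub_mul, hQQ, Matrix.smul_mul, Matrix.mul_assoc, hQQ,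
      Matrix.mul_one, Matrix.sub_mulVec, Matrix.one_mulVec, Matrix.smul_mulVec,
      Matrix.mulVec_neg, Matrix.mulVec_smul, Matrix.mulVec_mulVec, smul_neg, smul_smul,
      mul_inv_cancel_left₀ hγp.ne']
    abel
  have hL : Lc *ᵥ xbarp = 0 := by
    have : onesMat n *ᵥ dtil = (∑ i, dtil i) • onesVec n := by
      funext i
      simp [onesMat, onesVec, Matrix.mulVec, dotProduct]
    rw [hxbarp, this, Matrix.mulVec_neg, Matrix.mulVec_smul, Matrix.mulVec_smul, hLc1]
    simp
  have hxb : ∀ t, HasDerivAt xbar xbars t := by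
    intro t
    have e : xbar = fun t => xbar0 + t • xbars := funext hxbar
    rw [e]
    simpa using ((hasDerivAt_id t).smul_const xbars).const_add xbar0
  refine ⟨fun t ht => ?_, fun t ht => ?_, fun t ht => ?_⟩
  · refine (((hx t ht).sub (hxb t)).sub_const xhat).congr_deriv ?_
    rw [hE, hP, Matrix.mulVec_sub, smul_sub, hU]
    simp only [Matrix.mulVec_add, Matrix.mulVec_smul, smul_add]
    have h1 : d = dtil + xbars + Qinv *ᵥ r := by rw [hdtil]; abel
    rw [h1, ← hbar]
    linear_combination (exp := 1) hhat2
  · refine (((hxp t ht).sub_const xbarp).sub_const xhatp).congr_deriv ?_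
    rw [hE, hP]
    simp only [Matrix.mulVec_add, Matrix.mulVec_sub, Matrix.mulVec_smul, smul_add, smul_sub,
      hL, smul_zero] at hhat3 ⊢
    funext i
    have h3 := congrFun hhat3 i
    simp only [Pi.sub_apply, Pi.neg_apply, Pi.smul_apply, Pi.add_apply, Pi.zero_apply,
        smul_eq_mul] at h3 ⊢
    linear_combination h3
  · refine (((hxe t ht).sub_const xbare).sub_const xhate).congr_deriv ?_
    rw [Matrix.mulVec_sub Bᵀ (x t - xbar t) xhat, hhat1, sub_zero]
end

section
/- (Theorem 2.) Let Q = diag(q_1,…,q_n) with q_i > 0 and q_i ≠ q_j for some pair i, j; let B ∈ ℝ^{n×m} with ker(Bᵀ) = span{𝟙} be the incidence matrix of the (strongly connected) flow network; let B_c with ker(B_cᵀ) = span{𝟙} and L_c := B_c B_cᵀ be a connected communication Laplacian. Let d, r, x̄_0, x̄_s, u_p^-, u_p^+ ∈ ℝ^n, u_e^+ ∈ ℝ^m, x̄(t) := x̄_0 + x̄_s t, d̃ := d − x̄_s − Q^{-1}r, Q̄ := Q^{-1}𝟙𝟙ᵀQ^{-1}/(𝟙ᵀQ^{-1}𝟙)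 − Q^{-1}, ū_p := −Q^{-1}((𝟙𝟙ᵀ/(𝟙ᵀQ^{-1}𝟙))d̃ + r). Assume the feasibility condition: u_p^- < ū_p < u_p^+ componentwise, and there exists ū_e ∈ ℝ^m with B ū_e = Q̄ Q d̃ and 0 < ū_e < u_e^+ componentwise. Then for every ε₁ > 0 and ε₂ > 0 there exist gains γ_c, γ_e, γ_p, γ_l > 0 such that every differentiable solution (x, x_p, x_e) on [0,∞) of the closed loop ẋ = B u_e + u_p + d, ẋ_p = −γ_l L_c sat(x_p; (1/γ_p)(Qu_p^- + r), (1/γ_p)(Qu_p^+ + r)) − γ_p Q^{-1}((x − x̄(t)) − γ_c B u_e), ẋ_e = γ_e Bᵀ(x − x̄(t)), where u_e(t) := sat(−γ_c Bᵀ(x − x̄(t)) − γ_e x_e; 0, u_e^+) and u_p(t) := sat(Q^{-1}(γ_p x_p − r); u_p^-, u_p^+), satisfies: (i) u_p^- ≤ u_p(t) ≤ u_p^+ and 0 ≤ u_e(t) ≤ u_e^+ for all t ≥ 0; (ii) x(t) − x̄(t) converges as t → ∞ to a limit of Euclidean norm less than ε₁; (iii) u_p(t) converges as t → ∞ to a limit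 whose Euclidean distance to ū_p is less than ε₂. -/
open Matrix Filter

lemma sat1_eq {l u : ℝ} (h : l ≤ u) (y : ℝ) : sat1 y l u = max l (min y u) := by
  unfold sat1
  split_ifs with h1 h2
  · rw [min_eq_left (h1.trans h), max_eq_left h1]
  · rw [min_eq_right h2, max_eq_right h]
  · rw [min_eq_left (not_le.1 h2).le, max_eq_right (not_le.1 h1).le]

lemma sat1_mem {l u : ℝ} (h : l ≤ u) (y : ℝ) : l ≤ sat1 y l u ∧ sat1 y l u ≤ u := by
  rw [sat1_eq h]
  exact ⟨le_max_left _ _, max_le h (min_le_right _ _)⟩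

lemma sat1_of_mem {l u y : ℝ} (h1 : l < sat1 y l u) (h2 : sat1 y l u < u) : sat1 y l u = y := by
  unfold sat1 at *
  split_ifs at * <;> linarith

lemma sat1_lip {l u : ℝ} (h : l ≤ u) (a b : ℝ) : |sat1 a l u - sat1 b l u| ≤ |a - b| := by
  rw [sat1_eq h, sat1_eq h]
  calc _ ≤ |min a u - min b u| := by
        have := abs_max_sub_max_le_max l (min a u) l (min b u)
        simpa using this
    _ ≤ |a - b| := by
        have := abs_min_sub_min_le_max a u b u
        simpa using this

/-- potential of the saturation -/
noncomputable def satP (l u y : ℝ) : ℝ := y * sat1 y l u - (sat1 y l u) ^ 2 / 2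

lemma satP_ge {l u : ℝ} (_h : l ≤ u) (y s : ℝ) (h1 : l ≤ s) (h2 : s ≤ u) :
    y * s - s ^ 2 / 2 ≤ satP l u y := by
  unfold satP sat1
  split_ifs <;> nlinarith [sq_nonneg (y - s)]

lemma satP_hasDerivAt {l u : ℝ} (h : l ≤ u) (y : ℝ) :
    HasDerivAt (satP l u) (sat1 y l u) y := by
  rw [hasDerivAt_iff_isLittleO]
  have hO : (fun x' => satP l u x' - satP l u y - (x' - y) • sat1 y l u)
      =O[nhds y] fun x' => (x' - y) ^ 2 := by
    refine Asymptotics.IsBigO.of_bound 1 (Eventually.of_forall fun x' => ?_)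
    have a1 := satP_ge h x' (sat1 y l u) (sat1_mem h y).1 (sat1_mem h y).2
    have a2 := satP_ge h y (sat1 x' l u) (sat1_mem h x').1 (sat1_mem h x').2
    have a3 := sat1_lip h x' y
    have a4 : (sat1 x' l u - sat1 y l u) * (x' - y) ≤ (x' - y) ^ 2 := by
      calc _ ≤ |(sat1 x' l u - sat1 y l u) * (x' - y)| := le_abs_self _
        _ = |sat1 x' l u - sat1 y l u| * |x' - y| := abs_mul _ _
        _ ≤ |x' - y| * |x' - y| := by gcongr
        _ = _ := by rw [abs_mul_abs_self]; ring
    have e1 : satP l u y = y * sat1 y l u - (sat1 y l u) ^ 2 / 2 := rfl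
    have e2 : satP l u x' = x' * sat1 x' l u - (sat1 x' l u) ^ 2 / 2 := rfl
    rw [Real.norm_eq_abs, Real.norm_eq_abs, one_mul, abs_of_nonneg (sq_nonneg (x' - y)), smul_eq_mul,
      abs_le]
    constructor <;> nlinarith
  refine hO.trans_isLittleO ?_
  have : (fun x' : ℝ => (x' - y) ^ 2) =o[nhds y] fun x' => (x' - y) ^ 1 := by
    have ht : Tendsto (fun x' : ℝ => x' - y) (nhds y) (nhds 0) := by
      have : Continuous (fun x' : ℝ => x' - y) := by fun_prop
      simpa using this.tendsto y
    exact (Asymptotics.isLittleO_pow_pow one_lt_two).comp_tendsto ht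
  simpa using this

/-- coercivity -/
lemma satP_coercive {l u s : ℝ} (h1 : l < s) (h2 : s < u) :
    ∃ κ C : ℝ, 0 < κ ∧ ∀ y, κ * |y| - C ≤ satP l u y - s * y := by
  refine ⟨min (u - s) (s - l), u ^ 2 / 2 + l ^ 2 / 2, lt_min (by linarith) (by linarith), fun y => ?_⟩
  have hlu : l ≤ u := by linarith
  have a1 := satP_ge hlu y u hlu le_rfl
  have a2 := satP_ge hlu y l le_rfl hlu
  have b1 := min_le_left (u - s) (s - l)
  have b2 := min_le_right (u - s) (s - l)
  rcases abs_cases y with ⟨h, h'⟩ | ⟨h, h'⟩ <;> rw [h] <;> nlinarith [sq_nonneg u, sq_nonneg l]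

lemma satv_lip {k : ℕ} {l u : Fin k → ℝ} (h : ∀ i, l i ≤ u i) :
    LipschitzWith 1 (fun x => satv x l u) := by
  refine LipschitzWith.of_dist_le_mul fun x y => ?_
  rw [NNReal.coe_one, one_mul, dist_pi_le_iff dist_nonneg]
  intro i
  exact (sat1_lip (h i) (x i) (y i)).trans (dist_le_pi_dist x y i)

lemma lasalle {E F : Type*} [NormedAddCommGroup E] [NormedSpace ℝ E] [ProperSpace E]
    [TopologicalSpace F]
    (f : E → E) (K : NNReal) (hf : LipschitzWith K f) (X : ℝ → E)
    (hX : ∀ t ≥ (0:ℝ), HasDerivAt X (f (X t)) t) (R : ℝ) (hR : ∀ t ≥ (0:ℝ), ‖X t‖ ≤ R)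
    (V : E → ℝ) (hVc : Continuous V) (hV : AntitoneOn (fun t => V (X t)) (Set.Ici 0))
    (G : E → F) (hGc : Continuous G) (g0 : F)
    (hG : ∀ Y : ℝ → E, (∀ t > 0, HasDerivAt Y (f (Y t)) t) → (∀ t > 0, ‖Y t‖ ≤ R) →
      (∃ c, ∀ t > 0, V (Y t) = c) → G (Y 1) = g0) :
    Tendsto (fun t => G (X t)) atTop (nhds g0) := by
  have hVlim : ∃ c, Tendsto (fun t => V (X t)) atTop (nhds c) := by
    have hA : Antitone (fun t => V (X (max t 0))) := fun a b hab =>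
      hV (Set.mem_Ici.2 (le_max_right _ _)) (Set.mem_Ici.2 (le_max_right _ _)) (max_le_max hab le_rfl)
    have hb : BddBelow (Set.range (fun t => V (X (max t 0)))) := by
      obtain ⟨c, hc⟩ := ((isCompact_closedBall (0:E) R).image hVc).bddBelow
      refine ⟨c, ?_⟩
      rintro _ ⟨t, rfl⟩
      exact hc ⟨_, by simpa using hR _ (le_max_right t 0), rfl⟩
    refine ⟨_, (tendsto_atTop_ciInf hA hb).congr' ?_⟩
    filter_upwards [eventually_ge_atTop 0] with t ht
    rw [max_eq_left ht]
  obtain ⟨c, hc⟩ := hVlim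
  refine tendsto_of_subseq_tendsto fun ts hts => ?_
  have hts1 : Tendsto (fun k => ts k - 1) atTop atTop := tendsto_atTop_add_const_right _ _ hts
  obtain ⟨x0, -, φ, hφ, hx0⟩ := (isCompact_closedBall (0:E) R).tendsto_subseq'
    (x := fun k => X (ts k - 1)) (Eventually.frequently (by
      filter_upwards [hts1.eventually_ge_atTop 0] with k hk
      simpa using hR _ hk))
  obtain ⟨N, hN⟩ := eventually_atTop.1 ((hts1.comp hφ.tendsto_atTop).eventually_ge_atTop 0)
  set τ : ℕ → ℝ := fun k => ts (φ (k + N)) - 1 with hτ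
  have hτ0 : ∀ k, 0 ≤ τ k := fun k => hN _ (Nat.le_add_left _ _)
  have hτt : Tendsto τ atTop atTop :=
    (hts1.comp hφ.tendsto_atTop).comp (tendsto_add_atTop_nat N)
  have hXτ : Tendsto (fun k => X (τ k)) atTop (nhds x0) :=
    hx0.comp (tendsto_add_atTop_nat N)
  have hXk : ∀ k, ∀ s ≥ (0:ℝ), HasDerivAt (fun s => X (τ k + s)) (f (X (τ k + s))) s := by
    intro k s hs
    have := hX (τ k + s) (add_nonneg (hτ0 k) hs)
    exact this.comp_const_add (τ k) s
  have hgr : ∀ k l, ∀ s ≥ (0:ℝ), dist (X (τ k + s)) (X (τ l + s)) ≤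
      dist (X (τ k)) (X (τ l)) * Real.exp (K * s) := by
    intro k l s hs
    have := dist_le_of_trajectories_ODE (v := fun _ => f) (K := K)
      (f := fun s => X (τ k + s)) (g := fun s => X (τ l + s)) (a := 0) (b := s)
      (δ := dist (X (τ k)) (X (τ l))) (fun _ => hf)
      (fun t ht => (hXk k t ht.1).continuousAt.continuousWithinAt)
      (fun t ht => (hXk k t ht.1).hasDerivWithinAt)
      (fun t ht => (hXk l t ht.1).continuousAt.continuousWithinAt)
      (fun t ht => (hXk l t ht.1).hasDerivWithinAt) (by simp) s ⟨hs, le_rfl⟩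
    simpa using this
  have hY : ∀ s : ℝ, ∃ y, 0 ≤ s → Tendsto (fun k => X (τ k + s)) atTop (nhds y) := by
    intro s
    by_cases hs : 0 ≤ s
    · have hcs : CauchySeq (fun k => X (τ k + s)) := by
        have hc0 := hXτ.cauchySeq
        rw [Metric.cauchySeq_iff'] at hc0 ⊢
        intro ε hε
        obtain ⟨M, hM⟩ := hc0 (ε / Real.exp (K * s)) (by positivity)
        refine ⟨M, fun k hk => (hgr k M s hs).trans_lt ?_⟩
        rw [← lt_div_iff₀ (Real.exp_pos _)]
        exact hM k hk
      obtain ⟨y, hy⟩ := cauchySeq_tendsto_of_complete hcs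
      exact ⟨y, fun _ => hy⟩
    · exact ⟨0, fun h => absurd h hs⟩
  choose Y hY using hY
  have hYd : ∀ k, ∀ s ≥ (0:ℝ), dist (X (τ k + s)) (Y s) ≤
      dist (X (τ k)) x0 * Real.exp (K * s) := by
    intro k s hs
    have h1 : Tendsto (fun l => dist (X (τ k + s)) (X (τ l + s))) atTop
        (nhds (dist (X (τ k + s)) (Y s))) := tendsto_const_nhds.dist (hY s hs)
    have h2 : Tendsto (fun l => dist (X (τ k)) (X (τ l)) * Real.exp (K * s)) atTop
        (nhds (dist (X (τ k)) x0 * Real.exp (K * s))) :=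
      (tendsto_const_nhds.dist hXτ).mul_const _
    exact le_of_tendsto_of_tendsto' h1 h2 fun l => hgr k l s hs
  have hkey := hG Y ?_ ?_ ?_
  · refine ⟨fun k => φ (k + N), ?_⟩
    rw [← hkey]
    have := (hGc.tendsto (Y 1)).comp (hY 1 zero_le_one)
    refine this.congr fun k => ?_
    simp [hτ]
  · intro s hs
    refine hasDerivAt_of_tendstoUniformlyOn (s := Set.Ioo 0 (s + 1)) (l := atTop) (g := Y)
      (g' := fun s => f (Y s)) (f := fun k s => X (τ k + s)) (f' := fun k s => f (X (τ k + s))) isOpen_Ioo ?_ ?_ ?_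
      ⟨hs, by linarith⟩
    · rw [Metric.tendstoUniformlyOn_iff]
      intro ε hε
      have h0 : Tendsto (fun k => K * (dist (X (τ k)) x0 * Real.exp (K * (s+1)))) atTop (nhds 0) := by
        have := ((tendsto_iff_dist_tendsto_zero.1 hXτ).mul_const (Real.exp (K * (s+1)))).const_mul (K:ℝ)
        simpa using this
      filter_upwards [h0.eventually_lt_const hε] with k hk t ht
      rw [dist_comm]
      refine lt_of_le_of_lt ((hf.dist_le_mul _ _).trans ?_) hk
      refine mul_le_mul_of_nonneg_left ((hYd k t ht.1.le).trans ?_) K.2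
      have := ht.2.le
      gcongr
    · exact Eventually.of_forall fun k t ht => hXk k t ht.1.le
    · exact fun t ht => hY t ht.1.le
  · intro s hs
    exact le_of_tendsto' (hY s hs.le).norm fun k => hR _ (add_nonneg (hτ0 k) hs.le)
  · refine ⟨c, fun s hs => ?_⟩
    have h1 := (hVc.tendsto (Y s)).comp (hY s hs.le)
    have h2 : Tendsto (fun k => V (X (τ k + s))) atTop (nhds c) :=
      hc.comp (tendsto_atTop_add_const_right _ _ hτt)
    exact tendsto_nhds_unique h1 h2

lemma sat1_continuous {l u : ℝ} (h : l ≤ u) : Continuous (fun y => sat1 y l u) := by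
  have : (fun y => sat1 y l u) = fun y => max l (min y u) := funext (sat1_eq h)
  rw [this]; fun_prop

/-- a bounded function whose derivative is a positive multiple of `g` forces `g` not to stay
away from zero -/
lemma no_pos (g h : ℝ → ℝ) (k ε R : ℝ) (hk : 0 < k) (hε : 0 < ε)
    (hg : ContinuousOn g (Set.Ioi 0)) (hh : ∀ t > 0, HasDerivAt h (g t * k) t)
    (hR : ∀ t > 0, |h t| ≤ R) (hgap : ∀ t > 0, ¬ (0 < g t ∧ g t < ε)) :
    ∀ t > 0, g t ≤ 0 := by
  intro t1 ht1
  by_contra hpos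
  push Not at hpos
  have h1 : ∀ t > 0, ε ≤ g t := by
    intro t ht
    by_contra hlt
    push Not at hlt
    have hg0 : g t ≤ 0 := by
      by_contra h0
      exact hgap t ht ⟨not_le.1 h0, hlt⟩
    have he1 : ε ≤ g t1 := by
      by_contra h0
      exact hgap t1 ht1 ⟨hpos, not_le.1 h0⟩
    have := isPreconnected_Ioi.intermediate_value (a := t) (b := t1) ht ht1 hg
    obtain ⟨s, hs, hs'⟩ := this (show ε / 2 ∈ Set.Icc (g t) (g t1) from ⟨by linarith, by linarith⟩)
    exact hgap s hs (by rw [hs']; constructor <;> linarith)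
  have hmono : MonotoneOn (fun t => h t - ε * k * t) (Set.Ioi 0) := by
    have hd : ∀ t > 0, HasDerivAt (fun t => h t - ε * k * t) (g t * k - ε * k) t := by
      intro t ht
      have := (hh t ht).sub ((hasDerivAt_id t).const_mul (ε * k))
      simp only [id, mul_one] at this
      exact this
    refine monotoneOn_of_deriv_nonneg (convex_Ioi 0)
      (fun t ht => (hd t ht).continuousAt.continuousWithinAt)
      (fun t ht => (hd t (by simpa using ht)).differentiableAt.differentiableWithinAt) ?_
    intro t ht
    rw [(hd t (by simpa using ht)).deriv]
    nlinarith [h1 t (by simpa using ht)]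
  have hR0 : 0 ≤ R := (abs_nonneg _).trans (hR 1 one_pos)
  have hεk : 0 < ε * k := by positivity
  set T := (2 * R + 1) / (ε * k) with hT
  have hT0 : 0 < T := by positivity
  have := hmono (show (1:ℝ) ∈ Set.Ioi 0 from Set.mem_Ioi.2 one_pos) (show 1 + T ∈ Set.Ioi 0 from by
    simp only [Set.mem_Ioi]; linarith) (by linarith)
  have e : ε * k * T = 2 * R + 1 := by rw [hT]; field_simp
  have b1 := abs_le.1 (hR 1 one_pos)
  have b2 := abs_le.1 (hR (1 + T) (by linarith))
  simp only at this
  nlinarith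

lemma invariant_core {n : ℕ} (q : Fin n → ℝ) (hq : ∀ i, 0 < q i) (hq2 : ∃ i j, q i ≠ q j)
    (lo hi y : Fin n → ℝ) (hy : ∀ i, lo i < y i ∧ y i < hi i)
    (z p : ℝ → Fin n → ℝ) (a : ℝ → ℝ)
    (hz : ∀ t > 0, ∀ i, HasDerivAt (fun t => z t i) (a t * (q i)⁻¹) t)
    (hp : ∀ t > 0, ∀ i, HasDerivAt (fun t => p t i) (-((q i)⁻¹ * z t i)) t)
    (ha : ∀ t > 0, ∀ i, sat1 (p t i) (lo i) (hi i) = y i + a t)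
    (R : ℝ) (hR : ∀ t > 0, ∀ i, |z t i| ≤ R) :
    ∀ t > 0, a t = 0 ∧ ∀ i, z t i = 0 := by
  obtain ⟨i, j, hij⟩ := hq2
  have hac : ContinuousOn a (Set.Ioi 0) := by
    have h1 : ContinuousOn (fun t => sat1 (p t i) (lo i) (hi i) - y i) (Set.Ioi 0) := by
      have : ContinuousOn (fun t => p t i) (Set.Ioi 0) :=
        fun t ht => (hp t ht i).continuousAt.continuousWithinAt
      exact ((sat1_continuous ((hy i).1.trans (hy i).2).le).comp_continuousOn this).sub
        continuousOn_const
    refine h1.congr fun t ht => ?_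
    simp [ha t ht i]
  have hop : ∀ t > (0:ℝ), ∀ᶠ s in nhds t, 0 < s := fun t ht => eventually_gt_nhds ht
  have hmid : ∀ t > 0, (∀ i, lo i < y i + a t ∧ y i + a t < hi i) → a t = 0 := by
    intro t ht hin
    have hcont : ContinuousAt a t := hac.continuousAt (Ioi_mem_nhds ht)
    have hev : ∀ᶠ s in nhds t, ∀ i, lo i < y i + a s ∧ y i + a s < hi i := by
      rw [eventually_all]
      intro i
      have hc : Tendsto (fun s => y i + a s) (nhds t) (nhds (y i + a t)) :=
        tendsto_const_nhds.add hcont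
      exact (hc.eventually_const_lt (hin i).1).and (hc.eventually_lt_const (hin i).2)
    have hpe : ∀ᶠ s in nhds t, ∀ i, p s i = y i + a s := by
      filter_upwards [hev, hop t ht] with s hs hs0 i
      rw [← ha s hs0 i]
      refine (sat1_of_mem ?_ ?_).symm <;> rw [ha s hs0 i]
      · exact (hs i).1
      · exact (hs i).2
    have hze : ∀ᶠ s in nhds t, (q i)⁻¹ * z s i = (q j)⁻¹ * z s j := by
      filter_upwards [hpe.eventually_nhds, hop t ht] with s hs hs0
      have h1 := (hp s hs0 i).sub (hp s hs0 j)
      have h2 : HasDerivAt (fun s => p s i - p s j) 0 s := by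
        refine (hasDerivAt_const s (y i - y j)).congr_of_eventuallyEq ?_
        filter_upwards [hs] with r hr
        rw [hr i, hr j]; ring
      have := h1.unique h2
      linarith
    have h1 := ((hz t ht i).const_mul (q i)⁻¹).sub ((hz t ht j).const_mul (q j)⁻¹)
    have h2 : HasDerivAt (fun s => (q i)⁻¹ * z s i - (q j)⁻¹ * z s j) 0 t := by
      refine (hasDerivAt_const t (0:ℝ)).congr_of_eventuallyEq ?_
      filter_upwards [hze] with r hr
      rw [hr]; ring
    have h3 := h1.unique h2
    have h4 : a t * ((q i)⁻¹ ^ 2 - (q j)⁻¹ ^ 2) = 0 := by linarith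
    rcases mul_eq_zero.1 h4 with h | h
    · exact h
    · exfalso
      apply hij
      have pi := inv_pos.2 (hq i)
      have pj := inv_pos.2 (hq j)
      have : (q i)⁻¹ = (q j)⁻¹ := by
        have : (q i)⁻¹ ^ 2 = (q j)⁻¹ ^ 2 := by linarith
        exact (pow_left_inj₀ pi.le pj.le two_ne_zero).1 this
      exact inv_injective this
  -- a uniform margin
  obtain ⟨ε, hε, hεm⟩ : ∃ ε > 0, ∀ i, ε < y i - lo i ∧ ε < hi i - y i := by
    have : ∀ᶠ ε in nhdsWithin (0:ℝ) (Set.Ioi 0), ∀ i, ε < y i - lo i ∧ ε < hi i - y i := by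
      rw [eventually_all]
      intro i
      refine eventually_nhdsWithin_of_eventually_nhds ?_
      exact (eventually_lt_nhds (by linarith [(hy i).1])).and
        (eventually_lt_nhds (by linarith [(hy i).2]))
    obtain ⟨ε, h1, h2⟩ := (this.and self_mem_nhdsWithin).exists
    exact ⟨ε, h2, h1⟩
  have hle : ∀ t > 0, a t ≤ 0 := by
    refine no_pos a (fun t => z t i) (q i)⁻¹ ε R (inv_pos.2 (hq i)) hε hac
      (fun t ht => hz t ht i) (fun t ht => hR t ht i) ?_
    rintro t ht ⟨h1, h2⟩
    have := hmid t ht (fun i => ⟨by linarith [(hεm i).1], by linarith [(hεm i).2]⟩)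
    linarith
  have hge : ∀ t > 0, -a t ≤ 0 := by
    refine no_pos (fun t => -a t) (fun t => -z t i) (q i)⁻¹ ε R (inv_pos.2 (hq i)) hε hac.neg
      (fun t ht => ?_) (fun t ht => ?_) ?_
    · have := (hz t ht i).neg
      rw [neg_mul]
      exact this
    · simpa using hR t ht i
    · rintro t ht ⟨h1, h2⟩
      have := hmid t ht (fun i => ⟨by linarith [(hεm i).1], by linarith [(hεm i).2]⟩)
      linarith
  have h0 : ∀ t > 0, a t = 0 := fun t ht => le_antisymm (hle t ht) (by linarith [hge t ht])
  refine fun t ht => ⟨h0 t ht, fun k => ?_⟩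
  have hpk : ∀ᶠ s in nhds t, p s k = y k := by
    filter_upwards [hop t ht] with s hs
    have e := ha s hs k
    rw [h0 s hs, add_zero] at e
    rw [← e]
    refine (sat1_of_mem ?_ ?_).symm <;> rw [e]
    · exact (hy k).1
    · exact (hy k).2
  have h2 : HasDerivAt (fun s => p s k) 0 t :=
    (hasDerivAt_const t (y k)).congr_of_eventuallyEq hpk
  have h3 := (hp t ht k).unique h2
  have h4 : (q k)⁻¹ * z t k = 0 := by linarith
  rcases mul_eq_zero.1 h4 with h | h
  · exact absurd h (inv_pos.2 (hq k)).ne'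
  · exact h

/-- the autonomous closed-loop vector field in the coordinates (z, p, w) -/
noncomputable def vf {n m : ℕ} (B : Matrix (Fin n) (Fin m) ℝ) (Lc Qi : Matrix (Fin n) (Fin n) ℝ)
    (dt lo hi : Fin n → ℝ) (lw uw : Fin m → ℝ) (γ : ℝ)
    (X : (Fin n → ℝ) × (Fin n → ℝ) × (Fin m → ℝ)) : (Fin n → ℝ) × (Fin n → ℝ) × (Fin m → ℝ) :=
  (B *ᵥ satv X.2.2 lw uw + Qi *ᵥ satv X.2.1 lo hi + dt,
   -(Lc *ᵥ satv X.2.1 lo hi) - Qi *ᵥ (X.1 - γ • (B *ᵥ satv X.2.2 lw uw)),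
   -(γ • (Bᵀ *ᵥ (B *ᵥ satv X.2.2 lw uw + Qi *ᵥ satv X.2.1 lo hi + dt))) - Bᵀ *ᵥ X.1)

/-- the Lyapunov function -/
noncomputable def lyap {n m : ℕ} (lo hi zs y : Fin n → ℝ) (lw uw s : Fin m → ℝ)
    (X : (Fin n → ℝ) × (Fin n → ℝ) × (Fin m → ℝ)) : ℝ :=
  ∑ i, ((X.1 i - zs i) ^ 2 / 2) + ∑ i, (satP (lo i) (hi i) (X.2.1 i) - y i * X.2.1 i)
    + ∑ j, (satP (lw j) (uw j) (X.2.2 j) - s j * X.2.2 j)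

lemma vf_lip {n m : ℕ} (B : Matrix (Fin n) (Fin m) ℝ) (Lc Qi : Matrix (Fin n) (Fin n) ℝ)
    (dt lo hi : Fin n → ℝ) (lw uw : Fin m → ℝ) (γ : ℝ)
    (h1 : ∀ i, lo i ≤ hi i) (h2 : ∀ j, lw j ≤ uw j) :
    ∃ K, LipschitzWith K (vf B Lc Qi dt lo hi lw uw γ) := by
  let L : ((Fin n → ℝ) × (Fin n → ℝ) × (Fin m → ℝ)) →ₗ[ℝ]
      ((Fin n → ℝ) × (Fin n → ℝ) × (Fin m → ℝ)) :=
    { toFun := fun X => (B *ᵥ X.2.2 + Qi *ᵥ X.2.1,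
        -(Lc *ᵥ X.2.1) - Qi *ᵥ (X.1 - γ • (B *ᵥ X.2.2)),
        -(γ • (Bᵀ *ᵥ (B *ᵥ X.2.2 + Qi *ᵥ X.2.1))) - Bᵀ *ᵥ X.1)
      map_add' := by
        intro X Y
        ext i <;> simp [mulVec_add, mulVec_sub] <;> ring
      map_smul' := by
        intro c X
        ext i <;> simp [mulVec_add, mulVec_sub, mulVec_smul] <;> ring }
  have hS : LipschitzWith 1 (fun X : (Fin n → ℝ) × (Fin n → ℝ) × (Fin m → ℝ) =>
      (X.1, satv X.2.1 lo hi, satv X.2.2 lw uw)) := by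
    have a1 := (satv_lip h1).comp (LipschitzWith.prod_fst.comp
      (LipschitzWith.prod_snd (α := Fin n → ℝ) (β := (Fin n → ℝ) × (Fin m → ℝ))))
    have a2 := (satv_lip h2).comp (LipschitzWith.prod_snd.comp
      (LipschitzWith.prod_snd (α := Fin n → ℝ) (β := (Fin n → ℝ) × (Fin m → ℝ))))
    have := (LipschitzWith.prod_fst (α := Fin n → ℝ) (β := (Fin n → ℝ) × (Fin m → ℝ))).prodMk
      (a1.prodMk a2)
    simpa using this
  have hL := (LinearMap.toContinuousLinearMap L).lipschitz
  have hc := (hL.comp hS).add (LipschitzWith.const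
    ((dt, 0, -(γ • (Bᵀ *ᵥ dt))) : (Fin n → ℝ) × (Fin n → ℝ) × (Fin m → ℝ)))
  refine ⟨‖LinearMap.toContinuousLinearMap L‖₊ * 1 + 0, ?_⟩
  have hfun : vf B Lc Qi dt lo hi lw uw γ = fun x =>
      (⇑(LinearMap.toContinuousLinearMap L) ∘ fun X : (Fin n → ℝ) × (Fin n → ℝ) × (Fin m → ℝ) =>
        (X.1, satv X.2.1 lo hi, satv X.2.2 lw uw)) x + (dt, 0, -(γ • Bᵀ *ᵥ dt)) := by
    funext X
    simp only [vf, Function.comp, LinearMap.coe_toContinuousLinearMap', L, LinearMap.coe_mk,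
      AddHom.coe_mk]
    ext i <;> simp [mulVec_add] <;> ring
  rw [hfun]
  exact hc

lemma lyap_deriv {n m mc : ℕ} (q : Fin n → ℝ) (B : Matrix (Fin n) (Fin m) ℝ)
    (Bc : Matrix (Fin n) (Fin mc) ℝ)
    (dt lo hi : Fin n → ℝ) (lw uw : Fin m → ℝ) (γ : ℝ)
    (h1 : ∀ i, lo i ≤ hi i) (h2 : ∀ j, lw j ≤ uw j)
    (zs y : Fin n → ℝ) (s : Fin m → ℝ)
    (e1 : Bᵀ *ᵥ zs = 0) (e2 : B *ᵥ s + diagonal (fun i => (q i)⁻¹) *ᵥ y + dt = 0)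
    (e3 : (Bc * Bcᵀ) *ᵥ y + diagonal (fun i => (q i)⁻¹) *ᵥ (zs - γ • (B *ᵥ s)) = 0)
    (Y : ℝ → (Fin n → ℝ) × (Fin n → ℝ) × (Fin m → ℝ)) (t : ℝ)
    (hY : HasDerivAt Y (vf B (Bc * Bcᵀ) (diagonal fun i => (q i)⁻¹) dt lo hi lw uw γ (Y t)) t) :
    HasDerivAt (fun t => lyap lo hi zs y lw uw s (Y t))
      (-((Bcᵀ *ᵥ (satv (Y t).2.1 lo hi - y)) ⬝ᵥ (Bcᵀ *ᵥ (satv (Y t).2.1 lo hi - y)))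
        - γ * ((B *ᵥ (satv (Y t).2.2 lw uw - s)) ⬝ᵥ (B *ᵥ (satv (Y t).2.2 lw uw - s)))) t := by
  set Qi : Matrix (Fin n) (Fin n) ℝ := diagonal fun i => (q i)⁻¹ with hQi
  have d1 : HasDerivAt (fun t => (Y t).1) _ t := hY.fst
  have d2 : HasDerivAt (fun t => (Y t).2.1) _ t := hY.snd.fst
  have d3 : HasDerivAt (fun t => (Y t).2.2) _ t := hY.snd.snd
  set v := satv (Y t).2.1 lo hi with hv
  set sg := satv (Y t).2.2 lw uw with hsg
  have dd1 : HasDerivAt (fun t => ∑ i, (((Y t).1 i - zs i) ^ 2 / 2))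
      (((Y t).1 - zs) ⬝ᵥ (B *ᵥ sg + Qi *ᵥ v + dt)) t := by
    unfold dotProduct
    refine HasDerivAt.fun_sum fun i _ => ?_
    have := (((hasDerivAt_pi.1 d1 i).sub_const (zs i)).pow 2).div_const 2
    refine this.congr_deriv ?_
    simp [vf, hv, hsg]
    ring
  have dd2 : HasDerivAt (fun t => ∑ i, (satP (lo i) (hi i) ((Y t).2.1 i) - y i * (Y t).2.1 i))
      ((v - y) ⬝ᵥ (-((Bc * Bcᵀ) *ᵥ v) - Qi *ᵥ ((Y t).1 - γ • (B *ᵥ sg)))) t := by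
    unfold dotProduct
    refine HasDerivAt.fun_sum fun i _ => ?_
    have := ((satP_hasDerivAt (h1 i) ((Y t).2.1 i)).comp t (hasDerivAt_pi.1 d2 i)).sub
      ((hasDerivAt_pi.1 d2 i).const_mul (y i))
    refine this.congr_deriv ?_
    simp only [vf, Pi.sub_apply, hv, hsg]
    simp only [satv]
    ring
  have dd3 : HasDerivAt (fun t => ∑ j, (satP (lw j) (uw j) ((Y t).2.2 j) - s j * (Y t).2.2 j))
      ((sg - s) ⬝ᵥ (-(γ • (Bᵀ *ᵥ (B *ᵥ sg + Qi *ᵥ v + dt))) - Bᵀ *ᵥ (Y t).1)) t := by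
    unfold dotProduct
    refine HasDerivAt.fun_sum fun i _ => ?_
    have := ((satP_hasDerivAt (h2 i) ((Y t).2.2 i)).comp t (hasDerivAt_pi.1 d3 i)).sub
      ((hasDerivAt_pi.1 d3 i).const_mul (s i))
    refine this.congr_deriv ?_
    simp only [vf, Pi.sub_apply, hv, hsg]
    simp only [satv]
    ring
  refine ((dd1.add dd2).add dd3).congr_deriv ?_
  clear dd1 dd2 dd3 d1 d2 d3
  clear_value v sg
  set z := (Y t).1
  have f1 : B *ᵥ sg + Qi *ᵥ v + dt = B *ᵥ (sg - s) + Qi *ᵥ (v - y) := by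
    rw [mulVec_sub, mulVec_sub]
    have : dt = -(B *ᵥ s + Qi *ᵥ y) := (neg_eq_of_add_eq_zero_right e2).symm
    rw [this]; abel
  have f2 : -((Bc * Bcᵀ) *ᵥ v) - Qi *ᵥ (z - γ • (B *ᵥ sg)) =
      -(Bc *ᵥ (Bcᵀ *ᵥ (v - y))) - Qi *ᵥ (z - zs) + γ • (Qi *ᵥ (B *ᵥ (sg - s))) := by
    have e3' : (Bc * Bcᵀ) *ᵥ y = -(Qi *ᵥ (zs - γ • (B *ᵥ s))) := eq_neg_of_add_eq_zero_left e3
    rw [mulVec_mulVec, mulVec_sub (Bc * Bcᵀ), e3']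
    simp only [mulVec_sub, mulVec_smul, smul_sub]
    abel
  have f3 : Bᵀ *ᵥ z = Bᵀ *ᵥ (z - zs) := by rw [mulVec_sub, e1, sub_zero]
  rw [f1, f2, f3]
  have g1 : ∀ a b : Fin n → ℝ, a ⬝ᵥ (Qi *ᵥ b) = b ⬝ᵥ (Qi *ᵥ a) := by
    intro a b
    simp only [hQi, dotProduct, mulVec_diagonal]
    exact Finset.sum_congr rfl fun i _ => by ring
  have g2 : ∀ (a : Fin m → ℝ) (b : Fin n → ℝ), a ⬝ᵥ (Bᵀ *ᵥ b) = (B *ᵥ a) ⬝ᵥ b := by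
    intro a b
    rw [dotProduct_mulVec, vecMul_transpose]
  have g3 : ∀ (a : Fin mc → ℝ) (b : Fin n → ℝ), b ⬝ᵥ (Bc *ᵥ a) = (Bcᵀ *ᵥ b) ⬝ᵥ a := by
    intro a b
    rw [dotProduct_mulVec, mulVec_transpose]
  generalize z - zs = zt
  simp only [dotProduct_add, dotProduct_sub, dotProduct_neg, dotProduct_smul, smul_eq_mul, g2, g3]
  rw [g1 zt (v - y), g1 (v - y) (B *ᵥ (sg - s)), dotProduct_comm zt (B *ᵥ (sg - s))]
  ring

lemma dps_nonneg {k : ℕ} (v : Fin k → ℝ) : 0 ≤ v ⬝ᵥ v :=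
  Finset.sum_nonneg fun i _ => mul_self_nonneg (v i)

lemma sum_le_each {ι : Type*} [Fintype ι] (f : ι → ℝ) (C : ι → ℝ) (h : ∀ i, -C i ≤ f i) (i : ι) :
    f i ≤ ∑ j, f j + ∑ j, |C j| := by
  rw [← Finset.sum_add_distrib]
  have h1 : ∀ j ∈ Finset.univ, 0 ≤ f j + |C j| := fun j _ => by
    linarith [h j, le_abs_self (C j)]
  have := Finset.single_le_sum h1 (Finset.mem_univ i)
  linarith [abs_nonneg (C i)]

lemma lyap_bdd {n m : ℕ} (lo hi zs y : Fin n → ℝ) (lw uw s : Fin m → ℝ)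
    (hy : ∀ i, lo i < y i ∧ y i < hi i) (hs : ∀ j, lw j < s j ∧ s j < uw j) (c : ℝ) :
    ∃ R, ∀ X, lyap lo hi zs y lw uw s X ≤ c → ‖X‖ ≤ R := by
  choose κ C hκ hC using fun i => satP_coercive (hy i).1 (hy i).2
  choose κ' C' hκ' hC' using fun i => satP_coercive (hs i).1 (hs i).2
  set M := |c| + ∑ i, |C i| + ∑ i, |C' i| with hM
  have hM0 : 0 ≤ M := by positivity
  refine ⟨(M + 1 / 2) + ∑ i, |zs i| + ∑ i, (M + |C i|) / κ i + ∑ i, (M + |C' i|) / κ' i, fun X hX => ?_⟩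
  have p1 : ∀ i, 0 ≤ (M + |C i|) / κ i := fun i => div_nonneg (by positivity) (hκ i).le
  have p2 : ∀ i, 0 ≤ (M + |C' i|) / κ' i := fun i => div_nonneg (by positivity) (hκ' i).le
  have s0 : 0 ≤ ∑ i, |zs i| := by positivity
  have s1 : 0 ≤ ∑ i, (M + |C i|) / κ i := Finset.sum_nonneg fun i _ => p1 i
  have s2 : 0 ≤ ∑ i, (M + |C' i|) / κ' i := Finset.sum_nonneg fun i _ => p2 i
  unfold lyap at hX
  have l2 : ∀ i, -C i ≤ satP (lo i) (hi i) (X.2.1 i) - y i * X.2.1 i := fun i => by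
    have := hC i (X.2.1 i)
    have := mul_nonneg (hκ i).le (abs_nonneg (X.2.1 i))
    linarith
  have l3 : ∀ i, -C' i ≤ satP (lw i) (uw i) (X.2.2 i) - s i * X.2.2 i := fun i => by
    have := hC' i (X.2.2 i)
    have := mul_nonneg (hκ' i).le (abs_nonneg (X.2.2 i))
    linarith
  have b1 : 0 ≤ ∑ i, ((X.1 i - zs i) ^ 2 / 2) := Finset.sum_nonneg fun i _ => by positivity
  have b2 : -∑ i, |C i| ≤ ∑ i, (satP (lo i) (hi i) (X.2.1 i) - y i * X.2.1 i) := by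
    rw [← Finset.sum_neg_distrib]
    exact Finset.sum_le_sum fun i _ => (neg_le_neg (le_abs_self _)).trans (l2 i)
  have b3 : -∑ i, |C' i| ≤ ∑ i, (satP (lw i) (uw i) (X.2.2 i) - s i * X.2.2 i) := by
    rw [← Finset.sum_neg_distrib]
    exact Finset.sum_le_sum fun i _ => (neg_le_neg (le_abs_self _)).trans (l3 i)
  have hc := le_abs_self c
  rw [Prod.norm_def, Prod.norm_def]
  refine max_le ?_ (max_le ?_ ?_)
  · refine (pi_norm_le_iff_of_nonneg (by positivity)).2 fun i => ?_
    have := Finset.single_le_sum (f := fun i => (X.1 i - zs i) ^ 2 / 2)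
      (fun i _ => by positivity) (Finset.mem_univ i)
    have h2 := Finset.single_le_sum (f := fun i => |zs i|)
      (fun i _ => abs_nonneg _) (Finset.mem_univ i)
    have h3 : |X.1 i - zs i| ≤ M + 1 / 2 := by
      have : (X.1 i - zs i) ^ 2 / 2 ≤ M := by linarith
      rw [← sq_abs] at this
      nlinarith [sq_nonneg (|X.1 i - zs i| - 1)]
    have h4 : |X.1 i| ≤ |X.1 i - zs i| + |zs i| := by
      simpa using abs_add_le (X.1 i - zs i) (zs i)
    rw [Real.norm_eq_abs]
    linarith
  · refine (pi_norm_le_iff_of_nonneg (by positivity)).2 fun i => ?_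
    have h1 := sum_le_each _ _ l2 i
    have h2 := Finset.single_le_sum (f := fun i => (M + |C i|) / κ i)
      (fun i _ => p1 i) (Finset.mem_univ i)
    have h3 : |X.2.1 i| ≤ (M + |C i|) / κ i := by
      rw [le_div_iff₀ (hκ i)]
      have := hC i (X.2.1 i)
      have := le_abs_self (C i)
      nlinarith
    rw [Real.norm_eq_abs]
    linarith
  · refine (pi_norm_le_iff_of_nonneg (by positivity)).2 fun i => ?_
    have h1 := sum_le_each _ _ l3 i
    have h2 := Finset.single_le_sum (f := fun i => (M + |C' i|) / κ' i)
      (fun i _ => p2 i) (Finset.mem_univ i)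
    have h3 : |X.2.2 i| ≤ (M + |C' i|) / κ' i := by
      rw [le_div_iff₀ (hκ' i)]
      have := hC' i (X.2.2 i)
      have := le_abs_self (C' i)
      nlinarith
    rw [Real.norm_eq_abs]
    linarith

lemma satP_continuous {l u : ℝ} (h : l ≤ u) : Continuous (satP l u) :=
  continuous_iff_continuousAt.2 fun y => (satP_hasDerivAt h y).continuousAt

lemma core_conv {n m mc : ℕ} (q : Fin n → ℝ) (hq : ∀ i, 0 < q i) (hq2 : ∃ i j, q i ≠ q j)
    (B : Matrix (Fin n) (Fin m) ℝ) (Bc : Matrix (Fin n) (Fin mc) ℝ)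
    (hBc : LinearMap.ker Bcᵀ.mulVecLin = Submodule.span ℝ {onesVec n})
    (dt lo hi : Fin n → ℝ) (lw uw : Fin m → ℝ) (γ : ℝ) (hγ : 0 < γ)
    (zs y : Fin n → ℝ) (s : Fin m → ℝ)
    (hy : ∀ i, lo i < y i ∧ y i < hi i) (hs : ∀ j, lw j < s j ∧ s j < uw j)
    (e1 : Bᵀ *ᵥ zs = 0) (e2 : B *ᵥ s + diagonal (fun i => (q i)⁻¹) *ᵥ y + dt = 0)
    (e3 : (Bc * Bcᵀ) *ᵥ y + diagonal (fun i => (q i)⁻¹) *ᵥ (zs - γ • (B *ᵥ s)) = 0)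
    (X : ℝ → (Fin n → ℝ) × (Fin n → ℝ) × (Fin m → ℝ))
    (hX : ∀ t ≥ (0:ℝ),
      HasDerivAt X (vf B (Bc * Bcᵀ) (diagonal fun i => (q i)⁻¹) dt lo hi lw uw γ (X t)) t) :
    Tendsto (fun t => ((X t).1, satv (X t).2.1 lo hi)) atTop (nhds (zs, y)) := by
  have h1 : ∀ i, lo i ≤ hi i := fun i => ((hy i).1.trans (hy i).2).le
  have h2 : ∀ j, lw j ≤ uw j := fun i => ((hs i).1.trans (hs i).2).le
  obtain ⟨K, hK⟩ := vf_lip B (Bc * Bcᵀ) (diagonal fun i => (q i)⁻¹) dt lo hi lw uw γ h1 h2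
  have hder := lyap_deriv q B Bc dt lo hi lw uw γ h1 h2 zs y s e1 e2 e3
  have hanti : AntitoneOn (fun t => lyap lo hi zs y lw uw s (X t)) (Set.Ici 0) := by
    refine antitoneOn_of_deriv_nonpos (convex_Ici 0)
      (fun t ht => (hder X t (hX t ht)).continuousAt.continuousWithinAt)
      (fun t ht => (hder X t (hX t (interior_subset ht))).differentiableAt.differentiableWithinAt) ?_
    intro t ht
    rw [(hder X t (hX t (interior_subset ht))).deriv]
    have a1 := dps_nonneg (Bcᵀ *ᵥ (satv (X t).2.1 lo hi - y))
    have a2 := mul_nonneg hγ.le (dps_nonneg (B *ᵥ (satv (X t).2.2 lw uw - s)))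
    linarith
  obtain ⟨R, hR⟩ := lyap_bdd lo hi zs y lw uw s hy hs (lyap lo hi zs y lw uw s (X 0))
  have hVc : Continuous (lyap lo hi zs y lw uw s) := by
    unfold lyap
    refine (Continuous.add ?_ ?_).add ?_
    · fun_prop
    · refine continuous_finsetSum _ fun i _ => Continuous.sub ?_ (by fun_prop)
      exact (satP_continuous (h1 i)).comp (by fun_prop)
    · refine continuous_finsetSum _ fun i _ => Continuous.sub ?_ (by fun_prop)
      exact (satP_continuous (h2 i)).comp (by fun_prop)
  refine lasalle _ K hK X hX R (fun t ht => hR _ (hanti (Set.mem_Ici.2 le_rfl) ht ht)) _ hVc hanti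
    (fun X => (X.1, satv X.2.1 lo hi)) ?_ (zs, y) ?_
  · exact continuous_fst.prodMk ((satv_lip h1).continuous.comp (by fun_prop))
  intro Y hY hYR ⟨c, hc⟩
  have hzero : ∀ t > 0, Bcᵀ *ᵥ (satv (Y t).2.1 lo hi - y) = 0 ∧
      B *ᵥ (satv (Y t).2.2 lw uw - s) = 0 := by
    intro t ht
    have d1 := hder Y t (hY t ht)
    have d2 : HasDerivAt (fun t => lyap lo hi zs y lw uw s (Y t)) 0 t := by
      refine (hasDerivAt_const t c).congr_of_eventuallyEq ?_
      filter_upwards [eventually_gt_nhds ht] with r hr using hc r hr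
    have d3 := d1.unique d2
    have a1 := dps_nonneg (Bcᵀ *ᵥ (satv (Y t).2.1 lo hi - y))
    have a2 := dps_nonneg (B *ᵥ (satv (Y t).2.2 lw uw - s))
    have a3 := mul_nonneg hγ.le a2
    constructor
    · rw [← dotProduct_self_eq_zero]; linarith
    · rw [← dotProduct_self_eq_zero]
      have : γ * ((B *ᵥ (satv (Y t).2.2 lw uw - s)) ⬝ᵥ (B *ᵥ (satv (Y t).2.2 lw uw - s))) = 0 := by
        linarith
      exact (mul_eq_zero.1 this).resolve_left hγ.ne'
  have hav : ∀ t, ∃ a : ℝ, 0 < t → ∀ i, sat1 ((Y t).2.1 i) (lo i) (hi i) = y i + a := by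
    intro t
    by_cases ht : 0 < t
    · have hm : satv (Y t).2.1 lo hi - y ∈ LinearMap.ker Bcᵀ.mulVecLin := by
        rw [LinearMap.mem_ker, mulVecLin_apply]
        exact (hzero t ht).1
      rw [hBc, Submodule.mem_span_singleton] at hm
      obtain ⟨a, ha⟩ := hm
      refine ⟨a, fun _ i => ?_⟩
      have := congrFun ha i
      simp [onesVec, satv] at this
      linarith
    · exact ⟨0, fun h => absurd h ht⟩
  choose a ha using hav
  have hsv : ∀ t > 0, satv (Y t).2.1 lo hi = y + fun _ => a t := fun t ht =>
    funext fun i => ha t ht i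
  have hdt : dt = -(B *ᵥ s + diagonal (fun i => (q i)⁻¹) *ᵥ y) :=
    (neg_eq_of_add_eq_zero_right e2).symm
  have hBs : ∀ t > 0, B *ᵥ satv (Y t).2.2 lw uw = B *ᵥ s := fun t ht => by
    have := (hzero t ht).2
    rw [mulVec_sub] at this
    exact sub_eq_zero.1 this
  have hLv : ∀ t > 0, (Bc * Bcᵀ) *ᵥ satv (Y t).2.1 lo hi = (Bc * Bcᵀ) *ᵥ y := fun t ht => by
    have := (hzero t ht).1
    have h : (Bc * Bcᵀ) *ᵥ (satv (Y t).2.1 lo hi - y) = 0 := by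
      rw [← mulVec_mulVec, this, mulVec_zero]
    rw [mulVec_sub] at h
    exact sub_eq_zero.1 h
  have e3' : (Bc * Bcᵀ) *ᵥ y = -(diagonal (fun i => (q i)⁻¹) *ᵥ (zs - γ • (B *ᵥ s))) :=
    eq_neg_of_add_eq_zero_left e3
  have hfin := invariant_core q hq hq2 lo hi y hy (fun t i => (Y t).1 i - zs i) (fun t => (Y t).2.1) a
    ?_ ?_ ha (R + ‖zs‖) ?_ 1 one_pos
  · obtain ⟨g1, g2⟩ := hfin
    have g3 := hsv 1 one_pos
    rw [g1] at g3
    refine Prod.ext ?_ ?_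
    · funext i
      have := g2 i
      show (Y 1).1 i = zs i
      linarith
    · show satv (Y 1).2.1 lo hi = y
      rw [g3]
      funext i; simp
  · intro t ht i
    have d1 : HasDerivAt (fun t => (Y t).1) _ t := (hY t ht).fst
    refine ((hasDerivAt_pi.1 d1 i).sub_const (zs i)).congr_deriv ?_
    simp only [vf, hBs t ht, hsv t ht, hdt, mulVec_diagonal, Pi.add_apply, Pi.neg_apply]
    ring
  · intro t ht i
    have d1 : HasDerivAt (fun t => (Y t).2.1) _ t := (hY t ht).snd.fst
    refine (hasDerivAt_pi.1 d1 i).congr_deriv ?_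
    simp only [vf, hBs t ht, hLv t ht, e3', mulVec_diagonal, Pi.sub_apply, Pi.neg_apply]
    ring
  · intro t ht i
    calc |(Y t).1 i - zs i| ≤ |(Y t).1 i| + |zs i| := abs_sub _ _
      _ ≤ R + ‖zs‖ := by
        have h3 := norm_le_pi_norm (Y t).1 i
        have h4 := norm_le_pi_norm zs i
        have h5 := norm_fst_le (Y t)
        have h6 := hYR t ht
        rw [Real.norm_eq_abs] at h3 h4
        linarith

noncomputable def T0 {n k : ℕ} (g : Fin n → ℝ) (A : Matrix (Fin n) (Fin k) ℝ) :
    ((Fin n → ℝ) × ℝ) →L[ℝ] ((Fin n → ℝ) × ℝ) :=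
  LinearMap.toContinuousLinearMap
    { toFun := fun X => (A *ᵥ (Aᵀ *ᵥ X.1) + X.2 • g, g ⬝ᵥ X.1)
      map_add' := by
        intro X Y
        refine Prod.ext ?_ ?_
        · simp only [Prod.fst_add, Prod.snd_add, mulVec_add, add_smul, Prod.mk_add_mk]; abel
        · simp [dotProduct_add]
      map_smul' := by
        intro c X
        refine Prod.ext ?_ ?_
        · simp [mulVec_smul, smul_smul]
        · simp [dotProduct_smul] }

lemma T0_apply {n k : ℕ} (g : Fin n → ℝ) (A : Matrix (Fin n) (Fin k) ℝ) (y : Fin n → ℝ) (c : ℝ) :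
    T0 g A (y, c) = (A *ᵥ (Aᵀ *ᵥ y) + c • g, g ⬝ᵥ y) := rfl

lemma ones_orth {n k : ℕ} (A : Matrix (Fin n) (Fin k) ℝ)
    (hA : LinearMap.ker Aᵀ.mulVecLin = Submodule.span ℝ {onesVec n}) (u : Fin k → ℝ) :
    onesVec n ⬝ᵥ (A *ᵥ u) = 0 := by
  have h1 : onesVec n ∈ LinearMap.ker Aᵀ.mulVecLin := by
    rw [hA]; exact Submodule.mem_span_singleton_self _
  rw [LinearMap.mem_ker, mulVecLin_apply] at h1
  rw [dotProduct_mulVec, ← mulVec_transpose, h1, zero_dotProduct]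

lemma T0_unit {n k : ℕ} (g : Fin n → ℝ) (hg : onesVec n ⬝ᵥ g ≠ 0) (A : Matrix (Fin n) (Fin k) ℝ)
    (hA : LinearMap.ker Aᵀ.mulVecLin = Submodule.span ℝ {onesVec n}) : IsUnit (T0 g A) := by
  rw [ContinuousLinearMap.isUnit_iff_bijective]
  have hinj : Function.Injective (T0 g A) := by
    refine (injective_iff_map_eq_zero _).2 ?_
    rintro ⟨y, c⟩ h
    rw [T0_apply, Prod.mk_eq_zero] at h
    obtain ⟨h1, h2⟩ := h
    have hc : c = 0 := by
      have := congrArg (fun v => onesVec n ⬝ᵥ v) h1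
      simp only [dotProduct_add, ones_orth A hA, dotProduct_smul, dotProduct_zero, zero_add,
        smul_eq_mul] at this
      exact (mul_eq_zero.1 this).resolve_right hg
    subst hc
    rw [zero_smul, add_zero] at h1
    have h3 : Aᵀ *ᵥ y = 0 := by
      rw [← dotProduct_self_eq_zero]
      have := congrArg (fun v => y ⬝ᵥ v) h1
      simp only [dotProduct_zero] at this
      rwa [dotProduct_mulVec, ← mulVec_transpose] at this
    have hm : y ∈ LinearMap.ker Aᵀ.mulVecLin := by
      rw [LinearMap.mem_ker, mulVecLin_apply, h3]
    rw [hA, Submodule.mem_span_singleton] at hm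
    obtain ⟨a, rfl⟩ := hm
    rw [dotProduct_smul, dotProduct_comm, smul_eq_mul] at h2
    rw [(mul_eq_zero.1 h2).resolve_right hg]
    simp
  exact ⟨hinj, (LinearMap.injective_iff_surjective (f := (T0 g A).toLinearMap)).1 hinj⟩

lemma clm_inv_app {E : Type*} [NormedAddCommGroup E] [NormedSpace ℝ E] (T : E →L[ℝ] E)
    (hT : IsUnit T) (b : E) : T (Ring.inverse T b) = b := by
  have := Ring.mul_inverse_cancel T hT
  exact congrArg (fun S : E →L[ℝ] E => S b) this

/-- continuous right inverse of `B` on the zero-sum vectors -/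
lemma right_inv {n m : ℕ} (hn : 0 < n) (B : Matrix (Fin n) (Fin m) ℝ)
    (hB : LinearMap.ker Bᵀ.mulVecLin = Submodule.span ℝ {onesVec n}) :
    ∃ R : (Fin n → ℝ) →L[ℝ] (Fin m → ℝ), ∀ v, onesVec n ⬝ᵥ v = 0 → B *ᵥ (R v) = v := by
  have hg : onesVec n ⬝ᵥ onesVec n ≠ 0 := by
    simp [onesVec, dotProduct]; omega
  have hT := T0_unit (onesVec n) hg B hB
  refine ⟨(LinearMap.toContinuousLinearMap Bᵀ.mulVecLin).comp
    ((ContinuousLinearMap.fst ℝ _ _).comp ((Ring.inverse (T0 (onesVec n) B)).comp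
      (ContinuousLinearMap.inl ℝ _ _))), fun v hv => ?_⟩
  have h := clm_inv_app _ hT (v, (0:ℝ))
  simp only [ContinuousLinearMap.comp_apply, ContinuousLinearMap.inl_apply,
    ContinuousLinearMap.coe_fst', LinearMap.coe_toContinuousLinearMap', mulVecLin_apply]
  generalize Ring.inverse (T0 (onesVec n) B) (v, (0:ℝ)) = w at h
  obtain ⟨y, c⟩ := w
  rw [T0_apply, Prod.mk.injEq] at h
  have hc : c = 0 := by
    have := congrArg (fun v => onesVec n ⬝ᵥ v) h.1
    simp only [dotProduct_add, ones_orth B hB, dotProduct_smul, zero_add, hv, smul_eq_mul] at this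
    exact (mul_eq_zero.1 this).resolve_right hg
  have := h.1
  rw [hc, zero_smul, add_zero] at this
  exact this

lemma equil {n k : ℕ} (g : Fin n → ℝ) (hg : onesVec n ⬝ᵥ g ≠ 0) (A : Matrix (Fin n) (Fin k) ℝ)
    (hA : LinearMap.ker Aᵀ.mulVecLin = Submodule.span ℝ {onesVec n}) (dt : Fin n → ℝ) :
    ∃ (Yf : ℝ → Fin n → ℝ) (cf : ℝ → ℝ),
      Tendsto Yf (nhds 0) (nhds (-((onesVec n ⬝ᵥ dt) / (onesVec n ⬝ᵥ g)) • onesVec n)) ∧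
      Tendsto cf (nhds 0) (nhds 0) ∧
      ∀ᶠ η in nhds (0:ℝ),
        (A * Aᵀ) *ᵥ Yf η + diagonal g *ᵥ (cf η • onesVec n + η • (diagonal g *ᵥ Yf η + dt)) = 0 ∧
        onesVec n ⬝ᵥ (diagonal g *ᵥ Yf η + dt) = 0 := by
  have hT := T0_unit g hg A hA
  let T1 : ((Fin n → ℝ) × ℝ) →L[ℝ] ((Fin n → ℝ) × ℝ) :=
    (ContinuousLinearMap.inl ℝ _ _).comp ((LinearMap.toContinuousLinearMap
      (diagonal g * diagonal g).mulVecLin).comp (ContinuousLinearMap.fst ℝ _ _))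
  let T : ℝ → ((Fin n → ℝ) × ℝ) →L[ℝ] ((Fin n → ℝ) × ℝ) := fun η => T0 g A + η • T1
  have hTc : Continuous T := by fun_prop
  have hT00 : T 0 = T0 g A := by simp [T]
  have hTu : ∀ᶠ η in nhds (0:ℝ), IsUnit (T η) := by
    have : {S : ((Fin n → ℝ) × ℝ) →L[ℝ] ((Fin n → ℝ) × ℝ) | IsUnit S} ∈ nhds (T 0) :=
      Units.isOpen.mem_nhds (by rw [hT00]; exact hT)
    exact hTc.continuousAt this
  let b : ℝ → (Fin n → ℝ) × ℝ := fun η => (-(η • (diagonal g *ᵥ dt)), -(onesVec n ⬝ᵥ dt))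
  have hb : Continuous b := by fun_prop
  have hlim : Tendsto (fun η => Ring.inverse (T η) (b η)) (nhds 0)
      (nhds (Ring.inverse (T 0) (b 0))) := by
    have h1 : Tendsto (fun η => Ring.inverse (T η)) (nhds 0) (nhds (Ring.inverse (T 0))) := by
      have h2 : ContinuousAt Ring.inverse (T 0) := by
        rw [hT00]
        obtain ⟨u, hu⟩ := hT
        rw [← hu]
        exact NormedRing.inverse_continuousAt u
      exact h2.tendsto.comp hTc.continuousAt
    exact (isBoundedBilinearMap_apply.continuous.tendsto (Ring.inverse (T 0), b 0)).comp
      (h1.prodMk_nhds hb.continuousAt)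
  have hgd : ∀ y : Fin n → ℝ, onesVec n ⬝ᵥ (diagonal g *ᵥ y) = g ⬝ᵥ y := by
    intro y
    simp [dotProduct, mulVec_diagonal, onesVec]
  have h0 : Ring.inverse (T 0) (b 0) =
      (-((onesVec n ⬝ᵥ dt) / (onesVec n ⬝ᵥ g)) • onesVec n, 0) := by
    have hb0 : T0 g A (-((onesVec n ⬝ᵥ dt) / (onesVec n ⬝ᵥ g)) • onesVec n, 0) = b 0 := by
      rw [T0_apply]
      have h1 : onesVec n ∈ LinearMap.ker Aᵀ.mulVecLin := by
        rw [hA]; exact Submodule.mem_span_singleton_self _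
      rw [LinearMap.mem_ker, mulVecLin_apply] at h1
      refine Prod.ext ?_ ?_
      · simp [mulVec_smul, mulVec_neg, h1, b]
      · simp only [dotProduct_smul, smul_eq_mul, b]
        rw [dotProduct_comm g]
        field_simp
    rw [← hb0, hT00]
    exact congrArg (fun S : ((Fin n → ℝ) × ℝ) →L[ℝ] ((Fin n → ℝ) × ℝ) => S _)
      (Ring.inverse_mul_cancel _ hT)
  rw [h0] at hlim
  refine ⟨fun η => (Ring.inverse (T η) (b η)).1, fun η => (Ring.inverse (T η) (b η)).2,
    (continuous_fst.tendsto _).comp hlim, (continuous_snd.tendsto _).comp hlim, ?_⟩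
  filter_upwards [hTu] with η hη
  have h := clm_inv_app _ hη (b η)
  generalize Ring.inverse (T η) (b η) = w at h
  obtain ⟨y, c⟩ := w
  have h' : T η (y, c) = (A *ᵥ (Aᵀ *ᵥ y) + c • g + η • ((diagonal g * diagonal g) *ᵥ y),
      g ⬝ᵥ y + η • 0) := rfl
  rw [h', Prod.mk.injEq] at h
  have hg1 : diagonal g *ᵥ onesVec n = g := by
    funext i; simp [mulVec_diagonal, onesVec]
  constructor
  · have := h.1
    rw [← sub_eq_zero] at this
    rw [← this]
    simp only [mulVec_add, mulVec_smul, hg1, ← mulVec_mulVec, smul_add]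
    abel
  · rw [dotProduct_add, hgd]
    have := h.2
    simp only [smul_zero, add_zero] at this
    simp only
    rw [this]; ring

lemma sat1_scale_s18 (q p r l u : ℝ) (hq : 0 < q) :
    sat1 (q⁻¹ * (p - r)) l u = q⁻¹ * (sat1 p (q * l + r) (q * u + r) - r) := by
  have h1 : q⁻¹ * (p - r) ≤ l ↔ p ≤ q * l + r := by
    rw [inv_mul_le_iff₀ hq]; constructor <;> intro h <;> linarith
  have h2 : u ≤ q⁻¹ * (p - r) ↔ q * u + r ≤ p := by
    rw [le_inv_mul_iff₀ hq]; constructor <;> intro h <;> linarith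
  unfold sat1
  simp only [h1, h2]
  split_ifs <;> field_simp <;> ring

lemma euclNorm_continuous {k : ℕ} : Continuous (euclNorm (k := k)) := by
  unfold euclNorm
  exact (PiLp.continuous_toLp 2 _).norm

lemma euclNorm_zero {k : ℕ} : euclNorm (0 : Fin k → ℝ) = 0 := by
  simp [euclNorm]

/-- Theorem 2: with suitable gains, the saturated distributed
controllers keep the inputs within their bounds for all time and achieve practical
(quasi-optimal) regulation: `x − x̄` and `u_p` converge to limits within `ε₁` of `0`
and `ε₂` of `ū_p` respectively. -/
theorem theorem2_constrained_quasi_optimal_regulation {n m mc : ℕ}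
    (q : Fin n → ℝ) (hq : ∀ i, 0 < q i)
    (hq2 : ∃ i j, q i ≠ q j)
    (B : Matrix (Fin n) (Fin m) ℝ)
    (hB : LinearMap.ker Bᵀ.mulVecLin = Submodule.span ℝ {onesVec n})
    (Bc : Matrix (Fin n) (Fin mc) ℝ)
    (hBc : LinearMap.ker Bcᵀ.mulVecLin = Submodule.span ℝ {onesVec n})
    (Lc : Matrix (Fin n) (Fin n) ℝ) (hLc : Lc = Bc * Bcᵀ)
    (d r xbar0 xbars upm upp : Fin n → ℝ) (uep : Fin m → ℝ)
    (xbar : ℝ → Fin n → ℝ) (hxbar : ∀ t, xbar t = xbar0 + t • xbars)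
    (Q Qinv Qbar : Matrix (Fin n) (Fin n) ℝ)
    (hQ : Q = Matrix.diagonal q)
    (hQinv : Qinv = Matrix.diagonal fun i => (q i)⁻¹)
    (hQbar : Qbar =
      (onesVec n ⬝ᵥ (Qinv *ᵥ onesVec n))⁻¹ • (Qinv * onesMat n * Qinv) - Qinv)
    (dtil : Fin n → ℝ) (hdtil : dtil = d - xbars - Qinv *ᵥ r)
    (ubarp : Fin n → ℝ)
    (hubarp : ubarp = -(Qinv *ᵥ
      (((onesVec n ⬝ᵥ (Qinv *ᵥ onesVec n))⁻¹ • onesMat n) *ᵥ dtil + r)))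
    (hfeasp : ∀ i, upm i < ubarp i ∧ ubarp i < upp i)
    (hfease : ∃ ubare : Fin m → ℝ,
      B *ᵥ ubare = (Qbar * Q) *ᵥ dtil ∧ ∀ i, 0 < ubare i ∧ ubare i < uep i) :
    ∀ ε₁ ε₂ : ℝ, 0 < ε₁ → 0 < ε₂ →
    ∃ γc γe γp γl : ℝ, 0 < γc ∧ 0 < γe ∧ 0 < γp ∧ 0 < γl ∧
      ∀ (x xp : ℝ → Fin n → ℝ) (xe : ℝ → Fin m → ℝ)
        (ue : ℝ → Fin m → ℝ) (up : ℝ → Fin n → ℝ),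
        (∀ t, ue t = satv (-(γc • (Bᵀ *ᵥ (x t - xbar t))) - γe • xe t) 0 uep) →
        (∀ t, up t = satv (Qinv *ᵥ (γp • xp t - r)) upm upp) →
        (∀ t ≥ (0:ℝ), HasDerivAt x (B *ᵥ ue t + up t + d) t) →
        (∀ t ≥ (0:ℝ), HasDerivAt xp
          (-(γl • (Lc *ᵥ satv (xp t) (γp⁻¹ • (Q *ᵥ upm + r)) (γp⁻¹ • (Q *ᵥ upp + r))))
            - γp • (Qinv *ᵥ ((x t - xbar t) - γc • (B *ᵥ ue t)))) t) →
        (∀ t ≥ (0:ℝ), HasDerivAt xe (γe • (Bᵀ *ᵥ (x t - xbar t))) t) →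
        (∀ t ≥ (0:ℝ), ∀ i, upm i ≤ up t i ∧ up t i ≤ upp i) ∧
        (∀ t ≥ (0:ℝ), ∀ i, 0 ≤ ue t i ∧ ue t i ≤ uep i) ∧
        (∃ xinf : Fin n → ℝ,
          Tendsto (fun t => x t - xbar t) atTop (nhds xinf) ∧
          euclNorm xinf < ε₁) ∧
        (∃ upinf : Fin n → ℝ,
          Tendsto up atTop (nhds upinf) ∧
          euclNorm (upinf - ubarp) < ε₂) := by
  subst hLc hQ hQinv hQbar
  set g : Fin n → ℝ := fun i => (q i)⁻¹ with hgdef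
  obtain ⟨i0, j0, hij⟩ := hq2
  have hn : 0 < n := i0.pos
  have hg1 : diagonal g *ᵥ onesVec n = g := by
    funext i; simp [mulVec_diagonal, onesVec]
  have hgpos : ∀ i, 0 < g i := fun i => inv_pos.2 (hq i)
  have hg : onesVec n ⬝ᵥ g ≠ 0 := by
    have : 0 < onesVec n ⬝ᵥ g := by
      simp only [dotProduct, onesVec, one_mul]
      exact Finset.sum_pos (fun i _ => hgpos i) ⟨i0, Finset.mem_univ _⟩
    exact this.ne'
  rw [hg1] at hubarp hfease
  obtain ⟨ubare, hBu, hub⟩ := hfease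
  obtain ⟨Yf, cf, hYf, hcf, hev⟩ := equil g hg Bc hBc dtil
  obtain ⟨R, hR⟩ := right_inv hn B hB
  set ybar : Fin n → ℝ := -((onesVec n ⬝ᵥ dtil) / (onesVec n ⬝ᵥ g)) • onesVec n with hybar
  have honesM : ∀ v : Fin n → ℝ, onesMat n *ᵥ v = (onesVec n ⬝ᵥ v) • onesVec n := by
    intro v
    funext i
    simp [onesMat, mulVec, dotProduct, onesVec]
  have hup : ubarp = diagonal g *ᵥ (ybar - r) := by
    rw [hubarp, smul_mulVec, honesM, hybar]
    funext i
    simp only [mulVec_diagonal, Pi.neg_apply, Pi.add_apply, Pi.sub_apply, Pi.smul_apply, smul_eq_mul,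
      onesVec]
    ring
  have hBu' : B *ᵥ ubare = -(diagonal g *ᵥ ybar) - dtil := by
    rw [hBu, ← mulVec_mulVec, sub_mulVec, smul_mulVec, ← mulVec_mulVec, ← mulVec_mulVec, honesM]
    have hQQ : diagonal g *ᵥ (diagonal q *ᵥ dtil) = dtil := by
      funext i
      simp only [mulVec_diagonal, hgdef]
      rw [← mul_assoc, inv_mul_cancel₀ (hq i).ne', one_mul]
    rw [hQQ, hybar]
    funext i
    simp only [mulVec_diagonal, Pi.neg_apply, Pi.sub_apply, Pi.smul_apply, smul_eq_mul,
      onesVec]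
    ring
  intro ε₁ ε₂ hε₁ hε₂
  -- the equilibrium flow
  set sf : ℝ → Fin m → ℝ := fun η => ubare - R (diagonal g *ᵥ (Yf η - ybar)) with hsf
  have hmv : Continuous fun v : Fin n → ℝ => diagonal g *ᵥ v := by fun_prop
  have hsf0 : Tendsto sf (nhds 0) (nhds ubare) := by
    have hc : Continuous fun v : Fin n → ℝ => ubare - R (diagonal g *ᵥ (v - ybar)) :=
      continuous_const.sub (R.continuous.comp (hmv.comp (continuous_id.sub continuous_const)))
    have := (hc.tendsto ybar).comp hYf
    rw [sub_self, mulVec_zero, map_zero, sub_zero] at this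
    exact this
  have hev1 : ∀ᶠ η in nhds (0:ℝ), ∀ j, 0 < sf η j ∧ sf η j < uep j := by
    rw [eventually_all]
    intro j
    have hj : Tendsto (fun η => sf η j) (nhds 0) (nhds (ubare j)) := tendsto_pi_nhds.1 hsf0 j
    exact (hj.eventually_const_lt (hub j).1).and (hj.eventually_lt_const (hub j).2)
  have hupf : Tendsto (fun η => diagonal g *ᵥ (Yf η - r)) (nhds 0) (nhds ubarp) := by
    rw [hup]
    exact (hmv.tendsto _).comp (hYf.sub_const r)
  have hev2 : ∀ᶠ η in nhds (0:ℝ), ∀ i, upm i < (diagonal g *ᵥ (Yf η - r)) i ∧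
      (diagonal g *ᵥ (Yf η - r)) i < upp i := by
    rw [eventually_all]
    intro j
    have hj := tendsto_pi_nhds.1 hupf j
    exact (hj.eventually_const_lt (hfeasp j).1).and (hj.eventually_lt_const (hfeasp j).2)
  have hev3 : ∀ᶠ η in nhds (0:ℝ), euclNorm (cf η • onesVec n) < ε₁ := by
    have h1 : Tendsto (fun η => euclNorm (cf η • onesVec n)) (nhds 0) (nhds 0) := by
      have := (euclNorm_continuous.tendsto _).comp (hcf.smul_const (onesVec n))
      rw [zero_smul, euclNorm_zero] at this
      exact this
    exact h1.eventually_lt_const hε₁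
  have hev4 : ∀ᶠ η in nhds (0:ℝ), euclNorm (diagonal g *ᵥ (Yf η - r) - ubarp) < ε₂ := by
    have h1 : Tendsto (fun η => euclNorm (diagonal g *ᵥ (Yf η - r) - ubarp)) (nhds 0) (nhds 0) := by
      have := (euclNorm_continuous.tendsto _).comp (hupf.sub_const ubarp)
      rw [sub_self, euclNorm_zero] at this
      exact this
    exact h1.eventually_lt_const hε₂
  obtain ⟨η, ⟨hE, hs, hu, hn1, hn2⟩, hη⟩ := ((eventually_nhdsWithin_of_eventually_nhds
    (s := Set.Ioi (0:ℝ)) (hev.and (hev1.and (hev2.and (hev3.and hev4))))).and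
      self_mem_nhdsWithin).exists
  have hη : 0 < η := hη
  refine ⟨η, 1, 1, 1, hη, one_pos, one_pos, one_pos, ?_⟩
  intro x xp xe ue up hue hupt hx hxp hxe
  have hlu : ∀ i, upm i ≤ upp i := fun i => ((hfeasp i).1.trans (hfeasp i).2).le
  have h0u : ∀ j, (0 : Fin m → ℝ) j ≤ uep j := fun j => ((hub j).1.trans (hub j).2).le
  refine ⟨fun t _ i => ?_, fun t _ j => ?_, ?_⟩
  · rw [hupt t]; exact sat1_mem (hlu i) _
  · rw [hue t]; exact sat1_mem (h0u j) _
  set lo : Fin n → ℝ := diagonal q *ᵥ upm + r with hlo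
  set hi : Fin n → ℝ := diagonal q *ᵥ upp + r with hhi
  have hy : ∀ i, lo i < Yf η i ∧ Yf η i < hi i := by
    intro i
    have h1 := hu i
    simp only [mulVec_diagonal, Pi.sub_apply, hgdef] at h1
    rw [lt_inv_mul_iff₀ (hq i), inv_mul_lt_iff₀ (hq i)] at h1
    simp only [hlo, hhi, Pi.add_apply, mulVec_diagonal]
    constructor <;> linarith [h1.1, h1.2]
  have hBs : B *ᵥ sf η = -(diagonal g *ᵥ Yf η + dtil) := by
    have h1 : onesVec n ⬝ᵥ (diagonal g *ᵥ (Yf η - ybar)) = 0 := by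
      have h2 := ones_orth B hB ubare
      have h3 := hE.2
      rw [hBu', dotProduct_sub, dotProduct_neg] at h2
      rw [dotProduct_add] at h3
      rw [mulVec_sub, dotProduct_sub]
      linarith
    rw [hsf]
    simp only
    rw [mulVec_sub, hR _ h1, hBu', mulVec_sub]
    abel
  have hupv : ∀ t, up t = diagonal g *ᵥ (satv (xp t) lo hi - r) := by
    intro t
    rw [hupt t]
    funext i
    simp only [satv, mulVec_diagonal, Pi.sub_apply, one_smul, hgdef, hlo, hhi, Pi.add_apply]
    exact sat1_scale_s18 _ _ _ _ _ (hq i)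
  have hz : ∀ t ≥ (0:ℝ), HasDerivAt (fun t => x t - xbar t)
      (B *ᵥ ue t + diagonal g *ᵥ satv (xp t) lo hi + dtil) t := by
    intro t ht
    have hxb : HasDerivAt xbar xbars t := by
      have : xbar = fun t => xbar0 + t • xbars := funext hxbar
      rw [this]
      have h1 := ((hasDerivAt_id t).smul_const xbars).const_add xbar0
      simpa using h1
    refine ((hx t ht).sub hxb).congr_deriv ?_
    rw [hupv t, hdtil, mulVec_sub]
    abel
  have key := core_conv q hq ⟨i0, j0, hij⟩ B Bc hBc dtil lo hi 0 uep η hη (cf η • onesVec n) (Yf η)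
    (sf η) hy hs ?_ ?_ ?_
    (fun t => (x t - xbar t, xp t, -(η • (Bᵀ *ᵥ (x t - xbar t))) - xe t)) ?_
  · have k1 := (continuous_fst.tendsto _).comp key
    have k2 := (continuous_snd.tendsto _).comp key
    refine ⟨⟨cf η • onesVec n, k1, hn1⟩, ⟨diagonal g *ᵥ (Yf η - r), ?_, hn2⟩⟩
    have hup' : up = fun t => diagonal g *ᵥ (satv (xp t) lo hi - r) := funext hupv
    rw [hup']
    exact (hmv.tendsto _).comp (k2.sub_const r)
  · have h1 : onesVec n ∈ LinearMap.ker Bᵀ.mulVecLin := by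
      rw [hB]; exact Submodule.mem_span_singleton_self _
    rw [LinearMap.mem_ker, mulVecLin_apply] at h1
    rw [mulVec_smul, h1, smul_zero]
  · rw [hBs]
    abel
  · have := hE.1
    rw [hBs, smul_neg, sub_neg_eq_add]
    exact this
  · intro t ht
    have hue' : satv (-(η • (Bᵀ *ᵥ (x t - xbar t))) - xe t) 0 uep = ue t := by
      rw [hue t, one_smul]
    have hz' := hz t ht
    have hBz : HasDerivAt (fun t => Bᵀ *ᵥ (x t - xbar t))
        (Bᵀ *ᵥ (B *ᵥ ue t + diagonal g *ᵥ satv (xp t) lo hi + dtil)) t :=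
      (LinearMap.toContinuousLinearMap Bᵀ.mulVecLin).hasFDerivAt.comp_hasDerivAt t hz'
    have hw : HasDerivAt (fun t => -(η • (Bᵀ *ᵥ (x t - xbar t))) - xe t)
        (-(η • (Bᵀ *ᵥ (B *ᵥ ue t + diagonal g *ᵥ satv (xp t) lo hi + dtil)))
          - Bᵀ *ᵥ (x t - xbar t)) t := by
      have := ((hBz.const_smul η).neg).sub (hxe t ht)
      rw [one_smul] at this
      exact this
    have hp := hxp t ht
    simp only [inv_one, one_smul] at hp
    have := hz'.prodMk (hp.prodMk hw)
    refine this.congr_deriv ?_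
    simp only [vf, hue', hgdef]
end
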